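/- Let k be a perfect field of characteristic p > 0 and R = ⊕_{m≥0} R_m an ℕ-graded k-algebra of finite type with R₀ = k and R ≠ k. If the graded ring of differential operators D_{R/k} has no nonzero homogeneous elements of negative degree, then R does not have finite F-representation type. -/

import Mathlib

open DirectSum

/-- The Frobenius pushforward `F^e_* R`: the ring `R` viewed as a module over itself via
the `e`-th iterated Frobenius endomorphism. -/
def FrobPush (R : Type) [CommRing R] (p : ℕ) [ExpChar R p] (e : ℕ) : Type := R

instance (R : Type) [CommRing R] (p : ℕ) [ExpChar R p] (e : ℕ) :
    AddCommGroup (FrobPush R p e) := inferInstanceAs (AddCommGroup R)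

instance (R : Type) [CommRing R] (p : ℕ) [ExpChar R p] (e : ℕ) :
    Module R (FrobPush R p e) :=
  Module.compHom R (iterateFrobenius R p e)

/-- `R` has finite F-representation type: there are finitely many finitely generated
`R`-modules `M i` such that every `F^e_* R` is isomorphic to a direct sum of copies of
the `M i`. -/
def HasFFRT (R : Type) [CommRing R] (p : ℕ) [ExpChar R p] : Prop :=
  ∃ (n : ℕ) (M : Fin n → ModuleCat.{0} R),
    (∀ i, Module.Finite R (M i)) ∧
    ∀ e : ℕ, ∃ c : Fin n → ℕ,
      Nonempty ((FrobPush R p e) ≃ₗ[R] ⨁ i : Fin n, (Fin (c i) → M i))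

/-- If `R ⧸ I` is Artinian and `P` is a finite `R`-module, then strictly decreasing chains of
submodules of `P` containing `I • P` have bounded length. -/
theorem exists_chain_bound {R P : Type*} [CommRing R] (I : Ideal R) [IsArtinianRing (R ⧸ I)]
    [AddCommGroup P] [Module R P] [Module.Finite R P] :
    ∃ ℓ : ℕ, ∀ (L : ℕ) (N : ℕ → Submodule R P), (∀ j ≤ L, I • ⊤ ≤ N j) →
      (∀ j < L, N (j + 1) < N j) → L ≤ ℓ := by
  set Q := P ⧸ (I • ⊤ : Submodule R P)
  have hfin : Module.Finite (R ⧸ I) Q := Module.Finite.of_restrictScalars_finite R _ _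
  have hlen : Module.length R Q ≠ ⊤ := by
    have h := Module.length_eq_of_surjective (R := R ⧸ I) (S := R) (M := Q)
      Ideal.Quotient.mk_surjective
    exact h ▸ Module.length_ne_top
  obtain ⟨ℓ, hℓ⟩ := ENat.ne_top_iff_exists.mp hlen
  refine ⟨ℓ, fun L N hI hN ↦ ?_⟩
  let s : LTSeries (Submodule R Q) :=
    { length := L
      toFun := fun j ↦ (N (L - j)).map (Submodule.mkQ _)
      step := fun j ↦ by
        have hj := j.2
        have h1 : L - (j.castSucc : Fin (L + 1)) = (L - (j.succ : Fin (L + 1))) + 1 := by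
          simp only [Fin.val_castSucc, Fin.val_succ]; omega
        have h2 : N (L - (j.castSucc : Fin (L + 1))) < N (L - (j.succ : Fin (L + 1))) := by
          rw [h1]
          exact hN _ (by simp only [Fin.val_succ]; omega)
        refine lt_of_le_not_ge (Submodule.map_mono h2.le) fun h ↦ h2.not_ge ?_
        have h3 := Submodule.map_le_iff_le_comap.mp h
        rwa [Submodule.comap_map_mkQ, sup_eq_right.mpr (hI _ (Nat.sub_le _ _))] at h3 }
  have h := Order.LTSeries.length_le_krullDim s
  rw [← Module.coe_length, ← hℓ] at h
  exact_mod_cast h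

/-- If `R ⧸ I` is Artinian and `M` is a finite family of finite `R`-modules, then there is a
uniform bound on the length of chains of fully invariant submodules containing `I • X`, as `X`
ranges over the finite direct sums of copies of the `M i`. -/
theorem exists_fullyInvariant_chain_bound.{u} {R : Type*} [CommRing R] (I : Ideal R)
    [IsArtinianRing (R ⧸ I)] {n : ℕ} (M : Fin n → Type*) [∀ i, AddCommGroup (M i)]
    [∀ i, Module R (M i)] [∀ i, Module.Finite R (M i)] :
    ∃ ℓ : ℕ, ∀ (X : Type u) [AddCommGroup X] [Module R X] (c : Fin n → ℕ)
      (_ : X ≃ₗ[R] ⨁ i : Fin n, (Fin (c i) → M i)) (L : ℕ) (V : ℕ → Submodule R X),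
      (∀ j ≤ L, I • ⊤ ≤ V j) → (∀ j < L, V (j + 1) < V j) →
      (∀ j ≤ L, ∀ φ : X →ₗ[R] X, ∀ x ∈ V j, φ x ∈ V j) → L ≤ ℓ := by
  obtain ⟨ℓ, hℓ⟩ := exists_chain_bound (P := ∀ i, M i) I
  refine ⟨ℓ, fun X _ _ c e L V hI hV hinv ↦ ?_⟩
  let ι : ∀ i, Fin (c i) → M i →ₗ[R] X := fun i j ↦
    e.symm.toLinearMap ∘ₗ DirectSum.lof R _ (fun i ↦ Fin (c i) → M i) i ∘ₗ
      LinearMap.single R (fun _ ↦ M i) j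
  let π : ∀ i, Fin (c i) → X →ₗ[R] M i := fun i j ↦
    LinearMap.proj j ∘ₗ DirectSum.component R _ (fun i ↦ Fin (c i) → M i) i ∘ₗ e.toLinearMap
  have hsum : ∀ x, ∑ i, ∑ j, ι i j (π i j x) = x := by
    intro x
    apply e.injective
    simp only [map_sum, ι, π, LinearMap.comp_apply, LinearEquiv.coe_coe,
      LinearEquiv.apply_symm_apply, LinearMap.coe_single, LinearMap.proj_apply]
    simp only [← map_sum, Finset.univ_sum_single]
    ext i : 1
    simp [DirectSum.lof_eq_of, DirectSum.sum_apply, DirectSum.of_apply, DirectSum.component]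
    rfl
  let Φ : Submodule R X → Submodule R (∀ i, M i) := fun W ↦
    ⨅ i, ⨅ j, W.comap (ι i j ∘ₗ LinearMap.proj i)
  have hΦ : ∀ W q, q ∈ Φ W ↔ ∀ i j, ι i j (q i) ∈ W := by
    intro W q
    simp [Φ, Submodule.mem_iInf]
  refine hℓ L (fun j ↦ Φ (V j)) (fun j hj ↦ ?_) (fun j hj ↦ ?_)
  · refine Submodule.smul_le.mpr fun r hr q _ ↦ (hΦ _ _).mpr fun i j' ↦ hI j hj ?_
    rw [Pi.smul_apply, map_smul]
    exact Submodule.smul_mem_smul hr trivial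
  · refine lt_of_le_not_ge (fun q hq ↦ ?_) fun h ↦ (hV j hj).not_ge fun x hx ↦ ?_
    · exact (hΦ _ _).mpr fun i j' ↦ (hV j hj).le ((hΦ _ _).mp hq i j')
    · rw [← hsum x]
      refine Submodule.sum_mem _ fun i _ ↦ Submodule.sum_mem _ fun j' _ ↦ ?_
      have hq : Pi.single i (π i j' x) ∈ Φ (V j) := by
        refine (hΦ _ _).mpr fun i₁ j₁ ↦ ?_
        by_cases hi : i₁ = i
        · subst hi
          rw [Pi.single_eq_same]
          exact hinv j hj.le (ι i₁ j₁ ∘ₗ π i₁ j') x hx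
        · rw [Pi.single_eq_of_ne hi, map_zero]
          exact zero_mem _
      simpa using (hΦ _ _).mp (h hq) i j'

section Graded

variable {R : Type*} [CommRing R] (𝒜 : ℤ → AddSubgroup R) [GradedRing 𝒜]

/-- The elements of a `ℤ`-graded ring all of whose components have degree at least `n`. -/
def degreeGE (n : ℤ) : AddSubgroup R :=
  ⨅ i : {i : ℤ // i < n}, (GradedRing.proj 𝒜 i).ker

theorem mem_degreeGE {n : ℤ} {r : R} :
    r ∈ degreeGE 𝒜 n ↔ ∀ i < n, GradedRing.proj 𝒜 i r = 0 := by
  simp [degreeGE, AddSubgroup.mem_iInf, AddMonoidHom.mem_ker]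

theorem proj_of_mem {i : ℤ} {r : R} (hr : r ∈ 𝒜 i) : GradedRing.proj 𝒜 i r = r := by
  rw [GradedRing.proj_apply, DirectSum.decompose_of_mem_same 𝒜 hr]

theorem proj_of_mem_ne {i j : ℤ} {r : R} (hr : r ∈ 𝒜 i) (hij : i ≠ j) :
    GradedRing.proj 𝒜 j r = 0 := by
  rw [GradedRing.proj_apply, DirectSum.decompose_of_mem_ne 𝒜 hr hij]

theorem mem_degreeGE_of_mem {n i : ℤ} {r : R} (hr : r ∈ 𝒜 i) (hi : n ≤ i) :
    r ∈ degreeGE 𝒜 n :=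
  (mem_degreeGE 𝒜).mpr fun _ hj ↦ proj_of_mem_ne 𝒜 hr (by omega)

theorem degreeGE_anti {m n : ℤ} (h : m ≤ n) : degreeGE 𝒜 n ≤ degreeGE 𝒜 m := fun _ hr ↦
  (mem_degreeGE 𝒜).mpr fun i hi ↦ (mem_degreeGE 𝒜).mp hr i (hi.trans_le h)

open Classical in
/-- An additive subgroup containing `𝒜 i` for all `i ≥ n` contains `degreeGE 𝒜 n`. -/
theorem degreeGE_le {n : ℤ} {S : AddSubgroup R} (h : ∀ i, n ≤ i → 𝒜 i ≤ S) :
    degreeGE 𝒜 n ≤ S := by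
  intro r hr
  rw [← DirectSum.sum_support_decompose 𝒜 r]
  refine sum_mem fun i _ ↦ ?_
  by_cases hi : n ≤ i
  · exact h i hi (SetLike.coe_mem _)
  · have := (mem_degreeGE 𝒜).mp hr i (by omega)
    rw [GradedRing.proj_apply] at this
    rw [this]
    exact zero_mem _

theorem mul_mem_degreeGE {m n : ℤ} {r s : R} (hr : r ∈ degreeGE 𝒜 m) (hs : s ∈ degreeGE 𝒜 n) :
    r * s ∈ degreeGE 𝒜 (m + n) := by
  have h1 : degreeGE 𝒜 m ≤ (degreeGE 𝒜 (m + n)).comap (AddMonoidHom.mulRight s) := by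
    refine degreeGE_le 𝒜 fun i hi a ha ↦ ?_
    have h2 : degreeGE 𝒜 n ≤ (degreeGE 𝒜 (m + n)).comap (AddMonoidHom.mulLeft a) :=
      degreeGE_le 𝒜 fun j hj b hb ↦
        mem_degreeGE_of_mem 𝒜 (SetLike.mul_mem_graded ha hb) (by omega)
    exact h2 hs
  exact h1 hr

theorem pow_mem_degreeGE {r : R} (hr : r ∈ degreeGE 𝒜 1) (q : ℕ) : r ^ q ∈ degreeGE 𝒜 q := by
  induction q with
  | zero =>
    rw [pow_zero]
    exact mem_degreeGE_of_mem 𝒜 SetLike.GradedOne.one_mem (by simp)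
  | succ q ih =>
    rw [pow_succ]
    exact_mod_cast mul_mem_degreeGE 𝒜 ih hr

theorem degreeGE_zero (h : ∀ i : ℤ, i < 0 → 𝒜 i = ⊥) (r : R) : r ∈ degreeGE 𝒜 0 := by
  refine (mem_degreeGE 𝒜).mpr fun i hi ↦ ?_
  have := (DirectSum.decompose 𝒜 r i).2
  rw [← GradedRing.proj_apply] at this
  simpa only [h i hi, AddSubgroup.mem_bot] using this

/-- In a nonnegatively graded ring, `degreeGE 𝒜 n` is an ideal. -/
def idealGE (h : ∀ i : ℤ, i < 0 → 𝒜 i = ⊥) (n : ℤ) : Ideal R :=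
  { degreeGE 𝒜 n with
    smul_mem' := fun r s hs ↦ by
      have := mul_mem_degreeGE 𝒜 (degreeGE_zero 𝒜 h r) hs
      rwa [zero_add] at this }

theorem mem_idealGE (h : ∀ i : ℤ, i < 0 → 𝒜 i = ⊥) {n : ℤ} {r : R} :
    r ∈ idealGE 𝒜 h n ↔ r ∈ degreeGE 𝒜 n := Iff.rfl

/-- The degree `d` component of an additive endomorphism of a graded ring. -/
noncomputable def homogeneousPart (φ : R →+ R) (d : ℤ) : R →+ R :=
  (DirectSum.toAddMonoid fun m : ℤ ↦
    ((GradedRing.proj 𝒜 (m + d)).comp φ).comp (𝒜 m).subtype).comp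
    (DirectSum.decomposeAddEquiv 𝒜).toAddMonoidHom

theorem homogeneousPart_of_mem (φ : R →+ R) (d : ℤ) {m : ℤ} {r : R} (hr : r ∈ 𝒜 m) :
    homogeneousPart 𝒜 φ d r = GradedRing.proj 𝒜 (m + d) (φ r) := by
  simp [homogeneousPart, DirectSum.decompose_of_mem 𝒜 hr]

theorem homogeneousPart_mem (φ : R →+ R) (d m : ℤ) {r : R} (hr : r ∈ 𝒜 m) :
    homogeneousPart 𝒜 φ d r ∈ 𝒜 (m + d) := by
  rw [homogeneousPart_of_mem 𝒜 φ d hr, GradedRing.proj_apply]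
  exact SetLike.coe_mem _

theorem proj_mul_of_mem {i j : ℤ} {a b : R} (ha : a ∈ 𝒜 i) :
    GradedRing.proj 𝒜 (i + j) (a * b) = a * GradedRing.proj 𝒜 j b := by
  simp only [GradedRing.proj_apply]
  exact DirectSum.coe_decompose_mul_add_of_left_mem 𝒜 ha

open Classical in
/-- Homogeneous components of an `R^{p^e}`-linear map are `R^{p^e}`-linear. -/
theorem homogeneousPart_pow_mul (p e : ℕ) [ExpChar R p] (φ : R →+ R)
    (hφ : ∀ a b : R, φ (a ^ p ^ e * b) = a ^ p ^ e * φ b) (d : ℤ) (a b : R) :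
    homogeneousPart 𝒜 φ d (a ^ p ^ e * b) = a ^ p ^ e * homogeneousPart 𝒜 φ d b := by
  have key : ∀ i m : ℤ, ∀ a ∈ 𝒜 i, ∀ b ∈ 𝒜 m,
      homogeneousPart 𝒜 φ d (a ^ p ^ e * b) = a ^ p ^ e * homogeneousPart 𝒜 φ d b := by
    intro i m a ha b hb
    have hpow : a ^ p ^ e ∈ 𝒜 (p ^ e • i) := SetLike.pow_mem_graded _ ha
    rw [homogeneousPart_of_mem 𝒜 φ d (SetLike.mul_mem_graded hpow hb), hφ,
      homogeneousPart_of_mem 𝒜 φ d hb, add_assoc, proj_mul_of_mem 𝒜 hpow]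
  rw [← DirectSum.sum_support_decompose 𝒜 a, ← DirectSum.sum_support_decompose 𝒜 b,
    sum_pow_char_pow]
  rw [map_sum, Finset.sum_mul_sum, Finset.sum_mul_sum, map_sum]
  simp only [map_sum]
  exact Finset.sum_congr rfl fun _ _ ↦ Finset.sum_congr rfl fun _ _ ↦
    key _ _ _ (SetLike.coe_mem _) _ (SetLike.coe_mem _)

/-- If every homogeneous `R^{p^e}`-linear map of negative degree vanishes, then every
`R^{p^e}`-linear map preserves `degreeGE 𝒜 n`. -/
theorem map_mem_degreeGE (p e : ℕ) [ExpChar R p]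
    (hneg : ∀ δ : R →+ R, (∀ a b : R, δ (a ^ p ^ e * b) = a ^ p ^ e * δ b) →
      ∀ d : ℤ, d < 0 → (∀ m : ℤ, ∀ r ∈ 𝒜 m, δ r ∈ 𝒜 (m + d)) → δ = 0)
    (φ : R →+ R) (hφ : ∀ a b : R, φ (a ^ p ^ e * b) = a ^ p ^ e * φ b) {n : ℤ} {r : R}
    (hr : r ∈ degreeGE 𝒜 n) : φ r ∈ degreeGE 𝒜 n := by
  refine degreeGE_le 𝒜 (S := (degreeGE 𝒜 n).comap φ) (fun m hm s hs ↦ ?_) hr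
  refine (mem_degreeGE 𝒜).mpr fun i hi ↦ ?_
  have h0 := hneg (homogeneousPart 𝒜 φ (i - m)) (homogeneousPart_pow_mul 𝒜 p e φ hφ _) (i - m)
    (by omega) fun _ _ ↦ homogeneousPart_mem 𝒜 φ _ _
  have h1 := homogeneousPart_of_mem 𝒜 φ (i - m) hs
  rw [h0, add_sub_cancel] at h1
  exact h1.symm

end Graded

/-- The Frobenius pushforward of an ideal. -/
def Ideal.frobPush {R : Type} [CommRing R] (J : Ideal R) (p : ℕ) [ExpChar R p] (e : ℕ) :
    Submodule R (FrobPush R p e) :=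
  { J.toAddSubmonoid with
    smul_mem' := fun r _ hx ↦ J.mul_mem_left (r ^ p ^ e) hx }

/-- Let `k` be a perfect field of characteristic `p > 0` and `R` an
ℕ-graded `k`-algebra (domain) of finite type with `R₀ = k` and `R ≠ k`.  The
differential operators on `R` are (by Yekutieli) the additive maps that are
`R^{p^e}`-linear for some `e`, graded so that `δ` has degree `d` if `δ(R_m) ⊆ R_{m+d}`.
If `D_{R/k}` has no nonzero homogeneous elements of negative degree, then `R` does not
have finite F-representation type. -/
theorem stmt_14 {R : Type} [CommRing R] [IsDomain R]
    (p : ℕ) [Fact p.Prime] [CharP R p] [ExpChar R p]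
    (k : Type) [Field k] [ExpChar k p] [PerfectRing k p] [Algebra k R]
    [Algebra.FiniteType k R]
    (𝒜 : ℤ → AddSubgroup R) [GradedRing 𝒜]
    (hNNeg : ∀ i : ℤ, i < 0 → 𝒜 i = ⊥)
    (hk : ∀ c : k, algebraMap k R c ∈ 𝒜 0)
    (hk' : ∀ r ∈ 𝒜 0, ∃ c : k, algebraMap k R c = r)
    (hRnek : ∃ i : ℤ, 0 < i ∧ 𝒜 i ≠ ⊥)
    -- D_{R/k} has no nonzero homogeneous elements of negative degree:
    (hneg : ∀ (δ : R →+ R), (∃ e : ℕ, ∀ a b : R, δ (a ^ p ^ e * b) = a ^ p ^ e * δ b) →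
      ∀ d : ℤ, d < 0 → (∀ (m : ℤ), ∀ r ∈ 𝒜 m, δ r ∈ 𝒜 (m + d)) → δ = 0) :
    ¬ HasFFRT R p := by
  rintro ⟨n, M, hM, hF⟩
  set I := idealGE 𝒜 hNNeg 1
  have hArt : IsArtinianRing (R ⧸ I) := by
    refine Function.Surjective.isArtinianRing (f := algebraMap k (R ⧸ I)) fun y ↦ ?_
    obtain ⟨r, rfl⟩ := Ideal.Quotient.mk_surjective y
    have hr₀ : GradedRing.proj 𝒜 0 r ∈ 𝒜 0 := SetLike.coe_mem _
    obtain ⟨c, hc⟩ := hk' _ hr₀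
    refine ⟨c, ?_⟩
    change Ideal.Quotient.mk I (algebraMap k R c) = _
    rw [eq_comm, Ideal.Quotient.eq, hc, mem_idealGE, mem_degreeGE]
    intro i hi
    rw [map_sub]
    rcases (show i ≤ 0 by omega).lt_or_eq with h | rfl
    · rw [(mem_degreeGE 𝒜).mp (degreeGE_zero 𝒜 hNNeg r) i h, proj_of_mem_ne 𝒜 hr₀ h.ne', sub_zero]
    · rw [proj_of_mem 𝒜 hr₀, sub_self]
  obtain ⟨ℓ, hℓ⟩ := exists_fullyInvariant_chain_bound I fun i ↦ M i
  obtain ⟨i, hi, hne⟩ := hRnek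
  obtain ⟨⟨x, hx⟩, hne₀⟩ := AddSubgroup.ne_bot_iff_exists_ne_zero.mp hne
  have hx0 : x ≠ 0 := fun h ↦ hne₀ (Subtype.ext h)
  obtain ⟨e, he⟩ : ∃ e : ℕ, (ℓ + 1) * i ≤ ((p ^ e : ℕ) : ℤ) := by
    refine ⟨((ℓ + 1) * i).toNat, (Int.self_le_toNat _).trans ?_⟩
    exact_mod_cast (Nat.lt_pow_self (Fact.out : p.Prime).one_lt).le
  obtain ⟨c, ⟨f⟩⟩ := hF e
  have := hℓ (FrobPush R p e) c f (ℓ + 1) (fun j ↦ (idealGE 𝒜 hNNeg (j * i)).frobPush p e) ?_ ?_ ?_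
  · omega
  · refine fun j hj ↦ Submodule.smul_le.mpr fun r hr y _ ↦ ?_
    refine Ideal.mul_mem_right (show R from y) _ (?_ : r ^ p ^ e ∈ idealGE 𝒜 hNNeg (j * i))
    refine degreeGE_anti 𝒜 (le_trans ?_ he) (pow_mem_degreeGE 𝒜 hr _)
    exact mul_le_mul_of_nonneg_right (by exact_mod_cast hj) hi.le
  · intro j _
    have hlt : (j : ℤ) * i < ((j + 1 : ℕ) : ℤ) * i := by push_cast; linarith
    have hxj : x ^ j ∈ 𝒜 (j * i) := by
      simpa using SetLike.pow_mem_graded j hx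
    refine lt_of_le_not_ge (degreeGE_anti 𝒜 hlt.le) fun h ↦ ?_
    have h1 : x ^ j ∈ degreeGE 𝒜 (((j + 1 : ℕ) : ℤ) * i) := h (mem_degreeGE_of_mem 𝒜 hxj le_rfl)
    have h2 := (mem_degreeGE 𝒜).mp h1 _ hlt
    rw [proj_of_mem 𝒜 hxj] at h2
    exact pow_ne_zero j hx0 h2
  · intro j _ φ y hy
    exact map_mem_degreeGE 𝒜 p e (fun δ hδ ↦ hneg δ ⟨e, hδ⟩) φ.toAddMonoidHom
      (fun a b ↦ φ.map_smul a b) hy
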